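/- arXiv:1702.05781 — 4 statements merged into one kernel-verified Lean document; each statement's English description precedes it below -/
import Mathlib

section
/- With Q = I − R, α₂ = 1 − α₁, Ω̄ = QΩ + α₂RΩ − α₁R and r̄ = (Q + α₂R)r̃, a vector x ∈ ℝᵇ satisfies (I + Ω̄)x = r̄ if and only if it satisfies (I + Ω)x = r̃; i.e., the fixed points of the damped map x ↦ r̄ − Ω̄x coincide exactly with the fixed points of the undamped map x ↦ r̃ − Ωx. -/
/-- With `Q = I − R`, `α₂ = 1 − α₁`, `Ω̄ = QΩ + α₂RΩ − α₁R` and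
`r̄ = (Q + α₂R)r̃`, a vector `x` satisfies `(I + Ω̄)x = r̄` if and only if it
satisfies `(I + Ω)x = r̃`; i.e., the fixed points of the damped map
`x ↦ r̄ − Ω̄x` coincide exactly with the fixed points of the undamped map
`x ↦ r̃ − Ωx`. -/
theorem stmt_5 {b : ℕ} (hb : 0 < b) (Ω : Matrix (Fin b) (Fin b) ℝ)
    (rt : Fin b → ℝ)
    (d : Fin b → ℝ) (R : Matrix (Fin b) (Fin b) ℝ)
    (hR : R = Matrix.diagonal d) (hd : ∀ i, d i = 0 ∨ d i = 1)
    (α₁ α₂ : ℝ) (hα₁ : 0 < α₁) (hα₁' : α₁ < 1) (hα₂ : α₂ = 1 - α₁)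
    (Q : Matrix (Fin b) (Fin b) ℝ) (hQ : Q = 1 - R)
    (Ωbar : Matrix (Fin b) (Fin b) ℝ)
    (hΩbar : Ωbar = Q * Ω + α₂ • (R * Ω) - α₁ • R)
    (rbar : Fin b → ℝ) (hrbar : rbar = (Q + α₂ • R).mulVec rt) :
    ∀ x : Fin b → ℝ,
      (1 + Ωbar).mulVec x = rbar ↔ (1 + Ω).mulVec x = rt := by
  intro x
  have hD : Q + α₂ • R = Matrix.diagonal fun i => 1 - α₁ * d i := by
    subst hQ hα₂ hR
    ext i j
    by_cases hij : i = j
    · subst hij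
      simp
      ring
    · simp [hij]
  have hfactor : 1 + Ωbar = (Q + α₂ • R) * (1 + Ω) := by
    subst hΩbar hQ hα₂
    simp only [add_mul, sub_mul, mul_add, mul_one, one_mul, sub_smul, one_smul, Matrix.smul_mul]
    abel
  have hne : ∀ i, 1 - α₁ * d i ≠ 0 := by
    intro i
    rcases hd i with h | h <;> rw [h] <;> linarith
  rw [hfactor, hrbar, ← Matrix.mulVec_mulVec, hD]
  simp only [funext_iff, Matrix.mulVec_diagonal, mul_right_inj' (hne _)]
end

section
/- Let m ≥ 0, let r, v, Cₛ ∈ ℝ with v > 0 and Cₛ ≠ 0, let C₁, …, C_m ∈ ℝ, and let (r_b, v_b), b = 1, …, m, be means and positive variances. Then there exists a constant c > 0 such that for every s ∈ ℝ, ∫_{ℝᵐ} exp(−(r − Cₛ s − Σ_{b=1}^m C_b x_b)²/(2v)) · ∏_{b=1}^m (1/√(2π v_b)) exp(−(x_b − r_b)²/(2 v_b)) dx₁⋯dx_m = c · exp(−(s − r*)²/(2 v*)), where r* = (r − Σ_{b=1}^m C_b r_b)/Cₛ and v* = (v + Σ_{b=1}^m C_b² v_b)/Cₛ². In particular this integral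 of the product, viewed as a function of s, is a Gaussian with mean r* and variance v*. -/
open Real MeasureTheory

/-- One-dimensional Gaussian marginalization: averaging `exp (-(a - c x)² / (2 v))` against the
Gaussian density with mean `r` and variance `w`. -/
lemma integral_exp_neg_sq_mul_gaussian (a c r : ℝ) {v w : ℝ} (hv : 0 < v) (hw : 0 < w) :
    (∫ x : ℝ, Real.exp (-(a - c * x) ^ 2 / (2 * v)) *
        ((1 / Real.sqrt (2 * π * w)) * Real.exp (-(x - r) ^ 2 / (2 * w)))) =
      Real.sqrt (v / (v + c ^ 2 * w)) *
        Real.exp (-(a - c * r) ^ 2 / (2 * (v + c ^ 2 * w))) := by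
  have hW : 0 < v + c ^ 2 * w := by positivity
  set W := v + c ^ 2 * w with hWdef
  have complete_square : ∀ x : ℝ, Real.exp (-(a - c * x) ^ 2 / (2 * v)) *
        ((1 / Real.sqrt (2 * π * w)) * Real.exp (-(x - r) ^ 2 / (2 * w))) =
      (1 / Real.sqrt (2 * π * w) * Real.exp (-(a - c * r) ^ 2 / (2 * W))) *
        Real.exp (-(W / (2 * v * w)) * (x - (r * v + a * c * w) / W) ^ 2) := by
    intro x
    rw [mul_left_comm, ← Real.exp_add, mul_assoc (1 / _), ← Real.exp_add]
    congr 2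
    rw [hWdef] at hW ⊢
    field_simp
    ring
  simp_rw [complete_square]
  rw [integral_const_mul,
    integral_sub_right_eq_self (fun x : ℝ ↦ Real.exp (-(W / (2 * v * w)) * x ^ 2)),
    integral_gaussian, mul_right_comm]
  congr 1
  rw [one_div, ← Real.sqrt_inv, ← Real.sqrt_mul (by positivity)]
  congr 1
  field_simp

/-- The Gaussian density with mean `r` and variance `w > 0` is integrable. -/
lemma integrable_gaussian_density (r : ℝ) {w : ℝ} (hw : 0 < w) :
    Integrable fun x : ℝ ↦ (1 / Real.sqrt (2 * π * w)) * Real.exp (-(x - r) ^ 2 / (2 * w)) := by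
  refine Integrable.const_mul ?_ _
  convert! (integrable_exp_neg_mul_sq (b := 1 / (2 * w)) (by positivity)).comp_sub_right r using 3
  ring

/-- Multivariate Gaussian marginalization of `exp (-(a - ∑ b, C b * x b)² / (2 v))` against a
product of Gaussian densities. -/
lemma integral_exp_neg_sq_mul_prod_gaussian {m : ℕ} (a : ℝ) {v : ℝ} (hv : 0 < v)
    (C r w : Fin m → ℝ) (hw : ∀ b, 0 < w b) :
    (∫ x : Fin m → ℝ, Real.exp (-(a - ∑ b, C b * x b) ^ 2 / (2 * v)) *
        ∏ b, (1 / Real.sqrt (2 * π * w b)) * Real.exp (-(x b - r b) ^ 2 / (2 * w b))) =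
      Real.sqrt (v / (v + ∑ b, C b ^ 2 * w b)) *
        Real.exp (-(a - ∑ b, C b * r b) ^ 2 / (2 * (v + ∑ b, C b ^ 2 * w b))) := by
  induction m generalizing a with
  | zero => simp [hv.ne', integral_unique, measureReal_def, volume_pi]
  | succ m ih =>
    have hV : 0 < v + ∑ b : Fin m, C b.succ ^ 2 * w b.succ :=
      add_pos_of_pos_of_nonneg hv
        (Finset.sum_nonneg fun b _ ↦ mul_nonneg (sq_nonneg _) (hw b.succ).le)
    have hint : Integrable fun x : Fin (m + 1) → ℝ ↦
        Real.exp (-(a - ∑ b, C b * x b) ^ 2 / (2 * v)) *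
        ∏ b, (1 / Real.sqrt (2 * π * w b)) * Real.exp (-(x b - r b) ^ 2 / (2 * w b)) := by
      refine Integrable.bdd_mul (c := 1)
        (Integrable.fintype_prod fun b ↦ integrable_gaussian_density (r b) (hw b))
        (Continuous.aestronglyMeasurable (by fun_prop)) (ae_of_all _ fun x ↦ ?_)
      rw [Real.norm_eq_abs, Real.abs_exp, Real.exp_le_one_iff, neg_div, neg_nonpos]
      positivity
    have hmp := (volume_preserving_piFinSuccAbove (fun _ : Fin (m + 1) ↦ ℝ) 0).symm
    rw [← hmp.integral_comp', Measure.volume_eq_prod, integral_prod]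
    swap
    · exact (hmp.integrable_comp_emb (MeasurableEquiv.measurableEmbedding _)).2 hint
    simp only [MeasurableEquiv.piFinSuccAbove_symm_apply, Fin.insertNthEquiv_apply,
      Fin.insertNth_zero', Fin.sum_univ_succ, Fin.prod_univ_succ, Fin.cons_zero, Fin.cons_succ]
    have inner : ∀ x : ℝ, (∫ y : Fin m → ℝ,
        Real.exp (-(a - (C 0 * x + ∑ b : Fin m, C b.succ * y b)) ^ 2 / (2 * v)) *
        ((1 / Real.sqrt (2 * π * w 0)) * Real.exp (-(x - r 0) ^ 2 / (2 * w 0)) *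
        ∏ b : Fin m, (1 / Real.sqrt (2 * π * w b.succ)) *
          Real.exp (-(y b - r b.succ) ^ 2 / (2 * w b.succ)))) =
        Real.sqrt (v / (v + ∑ b : Fin m, C b.succ ^ 2 * w b.succ)) *
        (Real.exp (-((a - ∑ b : Fin m, C b.succ * r b.succ) - C 0 * x) ^ 2 /
          (2 * (v + ∑ b : Fin m, C b.succ ^ 2 * w b.succ))) *
        ((1 / Real.sqrt (2 * π * w 0)) * Real.exp (-(x - r 0) ^ 2 / (2 * w 0)))) := by
      intro x
      simp_rw [← sub_sub, mul_left_comm (Real.exp (-(a - C 0 * x - _) ^ 2 / (2 * v)))]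
      rw [integral_const_mul, ih (a - C 0 * x) (fun b ↦ C b.succ) (fun b ↦ r b.succ)
        (fun b ↦ w b.succ) fun b ↦ hw b.succ, sub_right_comm]
      ring
    simp_rw [inner]
    rw [integral_const_mul, integral_exp_neg_sq_mul_gaussian _ _ _ hV (hw 0), ← mul_assoc,
      ← Real.sqrt_mul (by positivity), div_mul_div_cancel₀ hV.ne', sub_sub,
      add_comm (C 0 * r 0), add_comm (C 0 ^ 2 * w 0), ← add_assoc]

/-- Factor-node-to-variable-node message computation of Gaussian belief
propagation: multiplying the factor's Gaussian
`exp(−(r − Cₛ s − Σ_b C_b x_b)²/(2v))` by the incoming Gaussian messages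
`(1/√(2π v_b)) exp(−(x_b − r_b)²/(2 v_b))` and marginalizing (integrating)
over `x₁, …, x_m` yields, as a function of `s`, a Gaussian with mean
`r* = (r − Σ_b C_b r_b)/Cₛ` and variance `v* = (v + Σ_b C_b² v_b)/Cₛ²`,
up to a positive multiplicative constant. -/
theorem stmt_9 (m : ℕ) (r v Cs : ℝ) (hv : 0 < v) (hCs : Cs ≠ 0)
    (C rb vb : Fin m → ℝ) (hvb : ∀ b, 0 < vb b)
    (rstar vstar : ℝ)
    (hrstar : rstar = (r - ∑ b, C b * rb b) / Cs)
    (hvstar : vstar = (v + ∑ b, (C b) ^ 2 * vb b) / Cs ^ 2) :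
    ∃ c : ℝ, 0 < c ∧ ∀ s : ℝ,
      (∫ x : Fin m → ℝ,
          Real.exp (-(r - Cs * s - ∑ b, C b * x b) ^ 2 / (2 * v)) *
            ∏ b, (1 / Real.sqrt (2 * π * vb b)) *
              Real.exp (-(x b - rb b) ^ 2 / (2 * vb b)))
        = c * Real.exp (-(s - rstar) ^ 2 / (2 * vstar)) := by
  have hV : 0 < v + ∑ b, C b ^ 2 * vb b :=
    add_pos_of_pos_of_nonneg hv
      (Finset.sum_nonneg fun b _ ↦ mul_nonneg (sq_nonneg _) (hvb b).le)
  refine ⟨Real.sqrt (v / (v + ∑ b, C b ^ 2 * vb b)), by positivity, fun s ↦ ?_⟩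
  rw [integral_exp_neg_sq_mul_prod_gaussian (r - Cs * s) hv C rb vb hvb, hrstar, hvstar]
  congr 2
  field_simp
  ring
end

section
/- Let f : ℝⁿ → ℝⁿ be a standard function, i.e., for all componentwise-nonnegative v, v′ ∈ ℝⁿ: (positivity) f(v) has all components strictly positive; (monotonicity) v ≥ v′ componentwise implies f(v) ≥ f(v′) componentwise; and (scalability) for every α > 1, α f(v) > f(α v) componentwise. Then f has at most one fixed point in the set of componentwise-nonnegative vectors. -/
/-- A nonnegative fixed point of a standard function lies below any other: scaling the second by
the largest ratio of components would otherwise contradict scalability at the component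
attaining that ratio. -/
theorem fixedPoint_le_of_standard {ι : Type*} [Fintype ι] (f : (ι → ℝ) → (ι → ℝ))
    (hpos : ∀ v : ι → ℝ, 0 ≤ v → ∀ i, 0 < f v i)
    (hmono : ∀ v v' : ι → ℝ, 0 ≤ v → 0 ≤ v' → v' ≤ v → f v' ≤ f v)
    (hscale : ∀ v : ι → ℝ, 0 ≤ v → ∀ α : ℝ, 1 < α → ∀ i, f (α • v) i < α * f v i)
    {v v' : ι → ℝ} (hv : 0 ≤ v) (hv' : 0 ≤ v') (hfv : f v = v) (hfv' : f v' = v') :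
    v ≤ v' := by
  intro i
  by_contra! hi
  have hv'_pos : ∀ k, 0 < v' k := fun k => by simpa only [hfv'] using hpos v' hv' k
  have : Nonempty ι := ⟨i⟩
  obtain ⟨j, hj⟩ := Finite.exists_max fun k => v k / v' k
  have hα : 1 < v j / v' j := ((one_lt_div (hv'_pos i)).2 hi).trans_le (hj i)
  have hle : v ≤ (v j / v' j) • v' := fun k => (div_le_iff₀ (hv'_pos k)).1 (hj k)
  have hf_le := hmono _ v (hv.trans hle) hv hle j
  have hf_lt := hscale v' hv' _ hα j
  rw [hfv', div_mul_cancel₀ _ (hv'_pos j).ne'] at hf_lt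
  rw [hfv] at hf_le
  exact hf_lt.not_ge hf_le

/-- A standard (interference) function in the sense of Yates — i.e. a map
`f : ℝⁿ → ℝⁿ` satisfying positivity, monotonicity, and scalability on the
nonnegative orthant — has at most one fixed point among componentwise
nonnegative vectors. -/
theorem stmt_12 {n : ℕ} (f : (Fin n → ℝ) → (Fin n → ℝ))
    (hpos : ∀ v : Fin n → ℝ, 0 ≤ v → ∀ i, 0 < f v i)
    (hmono : ∀ v v' : Fin n → ℝ, 0 ≤ v → 0 ≤ v' → v' ≤ v → f v' ≤ f v)
    (hscale : ∀ v : Fin n → ℝ, 0 ≤ v → ∀ α : ℝ, 1 < α → ∀ i,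
      f (α • v) i < α * f v i) :
    ∀ v v' : Fin n → ℝ, 0 ≤ v → 0 ≤ v' → f v = v → f v' = v' → v = v' := by
  intro v v' hv hv' hfv hfv'
  exact le_antisymm (fixedPoint_le_of_standard f hpos hmono hscale hv hv' hfv hfv')
    (fixedPoint_le_of_standard f hpos hmono hscale hv' hv hfv' hfv)
end

section
/- Let f : ℝⁿ → ℝⁿ be a standard function (satisfying positivity, monotonicity, and scalability on the nonnegative orthant) that possesses a fixed point v̂ with all components strictly positive. Then for every initial point v⁽⁰⁾ with all components strictly positive, the iterates v⁽ᵗ⁾ = f(v⁽ᵗ⁻¹⁾) converge to v̂ as τ → ∞. -/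
open Filter Topology

/-- `v` and `w` agree componentwise up to the multiplicative factor `α`. -/
def WithinFactor {n : ℕ} (w : Fin n → ℝ) (α : ℝ) (v : Fin n → ℝ) : Prop :=
  ∀ i, v i ≤ α * w i ∧ w i ≤ α * v i

theorem WithinFactor.mono {n : ℕ} {w v : Fin n → ℝ} {α β : ℝ} (h : WithinFactor w α v)
    (hw : 0 ≤ w) (hv : 0 ≤ v) (hαβ : α ≤ β) : WithinFactor w β v := fun i =>
  ⟨(h i).1.trans (mul_le_mul_of_nonneg_right hαβ (hw i)),
    (h i).2.trans (mul_le_mul_of_nonneg_right hαβ (hv i))⟩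

theorem exists_withinFactor {n : ℕ} {w v : Fin n → ℝ} (hw : ∀ i, 0 < w i)
    (hv : ∀ i, 0 < v i) : ∃ α, 1 < α ∧ WithinFactor w α v := by
  have h : ∀ᶠ α : ℝ in atTop, ∀ i, v i / w i ≤ α ∧ w i / v i ≤ α :=
    eventually_all.2 fun i => (eventually_ge_atTop _).and (eventually_ge_atTop _)
  obtain ⟨α, hα, h⟩ := ((eventually_gt_atTop (1 : ℝ)).and h).exists
  exact ⟨α, hα, fun i => ⟨(div_le_iff₀ (hw i)).1 (h i).1, (div_le_iff₀ (hv i)).1 (h i).2⟩⟩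

theorem tendsto_of_eventually_withinFactor {n : ℕ} {w : Fin n → ℝ} {u : ℕ → Fin n → ℝ}
    (h : ∀ α, 1 < α → ∀ᶠ t in atTop, WithinFactor w α (u t)) : Tendsto u atTop (𝓝 w) := by
  refine tendsto_pi_nhds.2 fun i => tendsto_order.2 ⟨fun l hl => ?_, fun l hl => ?_⟩
  · have hc : Tendsto (fun α : ℝ => α * l) (𝓝[>] 1) (𝓝 l) := by
      have : Continuous fun α : ℝ => α * l := by fun_prop
      simpa using (this.tendsto 1).mono_left nhdsWithin_le_nhds
    obtain ⟨α, hα, hαl⟩ := (eventually_mem_nhdsWithin.and (hc.eventually_lt_const hl)).exists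
    have hα : 1 < α := hα
    filter_upwards [h α hα] with t ht
    exact lt_of_mul_lt_mul_left (hαl.trans_le (ht i).2) (by linarith)
  · have hc : Tendsto (fun α : ℝ => α * w i) (𝓝[>] 1) (𝓝 (w i)) := by
      have : Continuous fun α : ℝ => α * w i := by fun_prop
      simpa using (this.tendsto 1).mono_left nhdsWithin_le_nhds
    obtain ⟨α, hα, hαl⟩ := (eventually_mem_nhdsWithin.and (hc.eventually_lt_const hl)).exists
    filter_upwards [h α hα] with t ht
    exact (ht i).1.trans_lt hαl

section StandardFunction

variable {n : ℕ} {f : (Fin n → ℝ) → (Fin n → ℝ)} {w : Fin n → ℝ}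

theorem WithinFactor.map
    (hmono : ∀ v v' : Fin n → ℝ, 0 ≤ v → 0 ≤ v' → v' ≤ v → f v' ≤ f v)
    (hscale : ∀ v : Fin n → ℝ, 0 ≤ v → ∀ α : ℝ, 1 < α → ∀ i, f (α • v) i < α * f v i)
    (hw : 0 ≤ w) (hfix : f w = w) {v : Fin n → ℝ} (hv : 0 ≤ v) {α : ℝ} (hα : 1 < α)
    (h : WithinFactor w α v) : WithinFactor w α (f v) := by
  have hα0 : 0 ≤ α := by linarith
  intro i
  have h1 := hmono (α • w) v (smul_nonneg hα0 hw) hv (fun j => (h j).1) i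
  have h2 := hmono (α • v) w (smul_nonneg hα0 hv) hw (fun j => (h j).2) i
  have h3 := hscale w hw α hα i
  rw [hfix] at h2 h3
  exact ⟨h1.trans h3.le, h2.trans (hscale v hv α hα i).le⟩

/-- A standard function strictly improves the approximation of its fixed point, uniformly for
factors near a given `a > 1`. -/
theorem exists_withinFactor_map_lt
    (hmono : ∀ v v' : Fin n → ℝ, 0 ≤ v → 0 ≤ v' → v' ≤ v → f v' ≤ f v)
    (hscale : ∀ v : Fin n → ℝ, 0 ≤ v → ∀ α : ℝ, 1 < α → ∀ i, f (α • v) i < α * f v i)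
    (hw : 0 ≤ w) (hfix : f w = w) {a : ℝ} (ha : 1 < a) :
    ∃ b > a, ∃ c, 1 < c ∧ c < a ∧
      ∀ v, 0 ≤ v → WithinFactor w b v → WithinFactor w c (f v) := by
  have ha0 : 0 < a := by linarith
  have hlim (x : ℝ) : Tendsto (fun r : ℝ => r * r * x) (𝓝[>] 1) (𝓝 x) := by
    have : Continuous fun r : ℝ => r * r * x := by fun_prop
    simpa using (this.tendsto 1).mono_left nhdsWithin_le_nhds
  have hwa : 0 ≤ a⁻¹ • w := smul_nonneg (by positivity) hw
  have hev : ∀ᶠ r : ℝ in 𝓝[>] 1,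
      ∀ i, r * r * f (a • w) i < a * w i ∧ r * r * w i < a * f (a⁻¹ • w) i := by
    refine eventually_all.2 fun i => ((hlim _).eventually_lt_const ?_).and
      ((hlim _).eventually_lt_const ?_)
    · simpa only [hfix] using hscale w hw a ha i
    · simpa only [smul_inv_smul₀ ha0.ne', hfix] using hscale _ hwa a ha i
  obtain ⟨r, ⟨hr, hra⟩, hri⟩ := ((eventually_mem_set.2 (Ioo_mem_nhdsGT ha)).and hev).exists
  have hr0 : 0 < r := by linarith
  refine ⟨r * a, by nlinarith, a / r, (one_lt_div hr0).2 hra, div_lt_self ha0 hr,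
    fun v hv h i => ?_⟩
  have haw : 0 ≤ a • w := smul_nonneg ha0.le hw
  have h1 := hmono (r • a • w) v (smul_nonneg hr0.le haw) hv
    (fun j => by simpa [mul_assoc] using (h j).1) i
  have h2 := hmono (r • v) (a⁻¹ • w) (smul_nonneg hr0.le hv) hwa
    (fun j => by
      have := (h j).2
      simp only [Pi.smul_apply, smul_eq_mul]
      rw [inv_mul_le_iff₀ ha0]
      linarith) i
  have h3 := hscale (a • w) haw r hr i
  have h4 := hscale v hv r hr i
  obtain ⟨h5, h6⟩ := hri i
  rw [div_mul_eq_mul_div, div_mul_eq_mul_div, le_div_iff₀ hr0, le_div_iff₀ hr0]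
  constructor
  · nlinarith [mul_le_mul_of_nonneg_left (h1.trans h3.le) hr0.le]
  · have h7 : r * (w i * r) ≤ r * (a * f v i) := by
      nlinarith [mul_le_mul_of_nonneg_left (h2.trans h4.le) ha0.le]
    exact le_of_mul_le_mul_left h7 hr0

end StandardFunction

/-- Yates' convergence theorem for standard interference functions: if a
standard function `f : ℝⁿ → ℝⁿ` (positivity, monotonicity, scalability on the
nonnegative orthant) possesses a fixed point `v̂` with all components strictly
positive, then for every initial point `v⁰` with all components strictly
positive, the iterates `v⁽ᵗ⁾ = f(v⁽ᵗ⁻¹⁾)`, i.e. `v⁽ᵗ⁾ = f^[τ] v⁰`, converge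
to `v̂` as `τ → ∞`. -/
theorem stmt_13 {n : ℕ} (f : (Fin n → ℝ) → (Fin n → ℝ))
    (hpos : ∀ v : Fin n → ℝ, 0 ≤ v → ∀ i, 0 < f v i)
    (hmono : ∀ v v' : Fin n → ℝ, 0 ≤ v → 0 ≤ v' → v' ≤ v → f v' ≤ f v)
    (hscale : ∀ v : Fin n → ℝ, 0 ≤ v → ∀ α : ℝ, 1 < α → ∀ i,
      f (α • v) i < α * f v i)
    (vhat : Fin n → ℝ) (hvhat_pos : ∀ i, 0 < vhat i) (hfix : f vhat = vhat) :
    ∀ v0 : Fin n → ℝ, (∀ i, 0 < v0 i) →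
      Filter.Tendsto (fun τ : ℕ => f^[τ] v0) Filter.atTop (nhds vhat) := by
  intro v0 hv0
  have hw : 0 ≤ vhat := fun i => (hvhat_pos i).le
  have hnonneg (t : ℕ) : 0 ≤ f^[t] v0 := by
    induction t with
    | zero => exact fun i => (hv0 i).le
    | succ t ih =>
      rw [Function.iterate_succ_apply']
      exact fun i => (hpos _ ih i).le
  let S : Set ℝ := {α | 1 < α ∧ ∃ t, WithinFactor vhat α (f^[t] v0)}
  have hne : S.Nonempty := by
    obtain ⟨α, hα, h⟩ := exists_withinFactor hvhat_pos hv0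
    exact ⟨α, hα, 0, h⟩
  have hbdd : BddBelow S := ⟨1, fun α hα => hα.1.le⟩
  have hinf : sInf S ≤ 1 := by
    by_contra! ha
    obtain ⟨b, hb, c, hc, hca, hmap⟩ := exists_withinFactor_map_lt hmono hscale hw hfix ha
    obtain ⟨α, ⟨-, t, ht⟩, hαb⟩ := exists_lt_of_csInf_lt hne hb
    refine (csInf_le hbdd (show c ∈ S from ⟨hc, t + 1, ?_⟩)).not_gt hca
    rw [Function.iterate_succ_apply']
    exact hmap _ (hnonneg t) (ht.mono hw (hnonneg t) hαb.le)
  refine tendsto_of_eventually_withinFactor fun x hx => ?_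
  obtain ⟨α, ⟨-, t, ht⟩, hαx⟩ := exists_lt_of_csInf_lt hne (hinf.trans_lt hx)
  filter_upwards [eventually_ge_atTop t] with s hs
  induction s, hs using Nat.le_induction with
  | base => exact ht.mono hw (hnonneg t) hαx.le
  | succ s _ ih =>
    rw [Function.iterate_succ_apply']
    exact ih.map hmono hscale hw hfix (hnonneg s) hx
end
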